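/- arXiv:math/9806047 — 7 statements merged into one kernel-verified Lean document; each statement's English description precedes it below -/
import Mathlib

section
/- Let ρ ≥ 1 and let Γ = (γ_{ij}) be a symmetric ρ×ρ integer matrix which is indecomposable, has nonnegative off-diagonal entries (γ_{ij} ≥ 0 for all i ≠ j), and which, viewed as a real symmetric matrix, has signature (1, ρ−1). Then there exist positive integers a₁, …, a_ρ such that the vector h = (a₁, …, a_ρ) satisfies (Γh)_j > 0 for every j ∈ {1,…,ρ} and hᵀΓh > 0. -/
open Matrix

/-- A symmetric matrix is indecomposable if its index set cannot be divided
into two nonempty subsets orthogonal to one another. -/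
def Matrix.Indecomposable {n : ℕ} {α : Type*} [Zero α]
    (A : Matrix (Fin n) (Fin n) α) : Prop :=
  ¬ ∃ I : Finset (Fin n), I.Nonempty ∧ Iᶜ.Nonempty ∧
      ∀ i ∈ I, ∀ j ∈ Iᶜ, A i j = 0

/-- A real symmetric matrix has signature `(1, n-1)` if it has exactly one
positive eigenvalue and `n - 1` negative eigenvalues, counted with
multiplicity. -/
def Matrix.HasSignatureOneHyperbolic {n : ℕ} (A : Matrix (Fin n) (Fin n) ℝ) : Prop :=
  ∃ hA : A.IsHermitian,
    (Finset.univ.filter fun i => 0 < hA.eigenvalues i).card = 1 ∧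
    (Finset.univ.filter fun i => hA.eigenvalues i < 0).card = n - 1

open Filter Topology

/-- If `c` bounds the eigenvalues of a Hermitian matrix `A` from above, then `c - A` is positive
semidefinite. -/
theorem Matrix.IsHermitian.posSemidef_algebraMap_sub {n : Type*} [Fintype n] [DecidableEq n]
    {A : Matrix n n ℝ} (hA : A.IsHermitian) {c : ℝ} (hc : ∀ i, hA.eigenvalues i ≤ c) :
    (algebraMap ℝ (Matrix n n ℝ) c - A).PosSemidef := by
  have hB : (algebraMap ℝ (Matrix n n ℝ) c - A).IsHermitian := by
    refine IsHermitian.sub ?_ hA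
    rw [Algebra.algebraMap_eq_smul_one]
    simp [IsHermitian]
  refine hB.posSemidef_iff_eigenvalues_nonneg.2 fun i => ?_
  have hi := hB.eigenvalues_mem_spectrum_real i
  rw [← spectrum.singleton_sub_eq, hA.spectrum_real_eq_range_eigenvalues] at hi
  obtain ⟨_, rfl, _, ⟨j, rfl⟩, h⟩ := Set.mem_sub.1 hi
  simpa [← h] using hc j

/-- If the off-diagonal entries are nonnegative, passing to absolute values does not decrease the
quadratic form. -/
theorem Matrix.dotProduct_mulVec_le_abs {n : Type*} [Fintype n] {A : Matrix n n ℝ}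
    (hoff : ∀ i j, i ≠ j → 0 ≤ A i j) (v : n → ℝ) :
    v ⬝ᵥ (A *ᵥ v) ≤ |v| ⬝ᵥ (A *ᵥ |v|) := by
  simp only [dotProduct, mulVec, Finset.mul_sum, Pi.abs_apply]
  refine Finset.sum_le_sum fun i _ => Finset.sum_le_sum fun j _ => ?_
  rw [mul_left_comm, mul_left_comm |v i|]
  obtain rfl | hij := eq_or_ne i j
  · rw [abs_mul_abs_self]
  · rw [← abs_mul]
    exact mul_le_mul_of_nonneg_left (le_abs_self _) (hoff i j hij)

/-- A nonzero nonnegative eigenvector of an indecomposable matrix with nonnegative off-diagonal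
entries is positive. -/
theorem Matrix.Indecomposable.eigenvector_pos {n : ℕ} {A : Matrix (Fin n) (Fin n) ℝ}
    (hA : A.Indecomposable) (hoff : ∀ i j, i ≠ j → 0 ≤ A i j) {c : ℝ} {w : Fin n → ℝ}
    (hw : ∀ i, 0 ≤ w i) (hne : w ≠ 0) (heig : A *ᵥ w = c • w) (i : Fin n) : 0 < w i := by
  by_contra hi
  refine hA ⟨Finset.univ.filter fun i => w i = 0, ⟨i, ?_⟩, ?_, fun k hk j hj => ?_⟩
  · simpa using le_antisymm (not_lt.1 hi) (hw i)
  · obtain ⟨j, hj⟩ := Function.ne_iff.1 hne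
    exact ⟨j, by simpa using hj⟩
  · have hk0 : w k = 0 := by simpa using hk
    have hj0 : w j ≠ 0 := by simpa using hj
    have hsum : ∑ l, A k l * w l = 0 := by
      simpa [mulVec, dotProduct, hk0] using congrFun heig k
    have hterm := (Finset.sum_eq_zero_iff_of_nonneg fun l _ => by
      obtain rfl | hkl := eq_or_ne k l
      · simp [hk0]
      · exact mul_nonneg (hoff k l hkl) (hw l)).1 hsum j (Finset.mem_univ j)
    exact (mul_eq_zero.1 hterm).resolve_right hj0

/-- An indecomposable Hermitian matrix with nonnegative off-diagonal entries and a positive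
eigenvalue has a positive eigenvector for a positive eigenvalue. -/
theorem Matrix.Indecomposable.exists_pos_eigenvector {n : ℕ} {A : Matrix (Fin n) (Fin n) ℝ}
    (hA : A.Indecomposable) (hoff : ∀ i j, i ≠ j → 0 ≤ A i j) (hH : A.IsHermitian)
    (hpos : ∃ i, 0 < hH.eigenvalues i) :
    ∃ c : ℝ, 0 < c ∧ ∃ w : Fin n → ℝ, (∀ i, 0 < w i) ∧ A *ᵥ w = c • w := by
  obtain ⟨i₀, hi₀⟩ := hpos
  have : Nonempty (Fin n) := ⟨i₀⟩
  obtain ⟨m, hm⟩ := Finite.exists_max hH.eigenvalues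
  set c := hH.eigenvalues m
  let v : Fin n → ℝ := ⇑(hH.eigenvectorBasis m)
  have hv : A *ᵥ v = c • v := hH.mulVec_eigenvectorBasis m
  have hv0 : v ≠ 0 := fun h => hH.eigenvectorBasis.orthonormal.ne_zero m (by
    ext i
    exact congrFun h i)
  have hP := hH.posSemidef_algebraMap_sub hm
  have hmul (x : Fin n → ℝ) : (algebraMap ℝ (Matrix (Fin n) (Fin n) ℝ) c - A) *ᵥ x =
      c • x - A *ᵥ x := by
    rw [sub_mulVec, Algebra.algebraMap_eq_smul_one, smul_mulVec, one_mulVec]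
  have habs : |v| ⬝ᵥ |v| = v ⬝ᵥ v := by simp [dotProduct]
  have habs0 : |v| ≠ 0 := fun h => hv0 (funext fun i => abs_eq_zero.1 (congrFun h i))
  have hzero : star |v| ⬝ᵥ ((algebraMap ℝ (Matrix (Fin n) (Fin n) ℝ) c - A) *ᵥ |v|) = 0 := by
    refine le_antisymm ?_ (hP.dotProduct_mulVec_nonneg _)
    have hle := dotProduct_mulVec_le_abs hoff v
    rw [hv, dotProduct_smul, ← habs] at hle
    rw [hmul, star_trivial, dotProduct_sub, dotProduct_smul]
    exact sub_nonpos.2 hle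
  have heig : A *ᵥ |v| = c • |v| := by
    rw [hP.dotProduct_mulVec_zero_iff, hmul, sub_eq_zero] at hzero
    exact hzero.symm
  exact ⟨c, hi₀.trans_le (hm i₀), |v|,
    hA.eigenvector_pos hoff (fun i => abs_nonneg (v i)) habs0 heig, heig⟩

/-- An open set containing a vector with nonnegative coordinates contains a positive multiple of a
vector of natural numbers. -/
theorem exists_nat_vector_smul_mem_of_isOpen {n : Type*} {U : Set (n → ℝ)}
    (hU : IsOpen U) {w : n → ℝ} (hw : ∀ i, 0 ≤ w i) (hwU : w ∈ U) :
    ∃ (t : ℝ) (a : n → ℕ), 0 < t ∧ t⁻¹ • (fun i => (a i : ℝ)) ∈ U := by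
  have hlim : Tendsto (fun (t : ℝ) (i : n) => (⌊w i * t⌋₊ : ℝ) / t) atTop (𝓝 w) :=
    tendsto_pi_nhds.2 fun i => tendsto_nat_floor_mul_div_atTop (hw i)
  obtain ⟨t, htU, ht⟩ := ((hlim.eventually_mem (hU.mem_nhds hwU)).and (eventually_gt_atTop 0)).exists
  refine ⟨t, fun i => ⌊w i * t⌋₊, ht, ?_⟩
  convert htU using 1
  ext i
  simp [div_eq_inv_mul]

/-- Lemma 1.2 in matrix form: for an indecomposable symmetric integer matrix
`Γ` of signature `(1, ρ-1)` with nonnegative off-diagonal entries, there are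
positive integers `a₁, …, a_ρ` such that `h = (a₁, …, a_ρ)` satisfies
`(Γh)_j > 0` for all `j` and `hᵀΓh > 0`. -/
theorem exists_positive_integer_vector
    (ρ : ℕ) (hρ : 1 ≤ ρ) (Γ : Matrix (Fin ρ) (Fin ρ) ℤ)
    (hsym : Γ.IsSymm)
    (hindec : Γ.Indecomposable)
    (hoff : ∀ i j : Fin ρ, i ≠ j → 0 ≤ Γ i j)
    (hsig : (Γ.map (Int.cast : ℤ → ℝ)).HasSignatureOneHyperbolic) :
    ∃ a : Fin ρ → ℤ, (∀ i, 0 < a i) ∧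
      (∀ j, 0 < (Γ *ᵥ a) j) ∧ 0 < a ⬝ᵥ (Γ *ᵥ a) := by
  obtain ⟨hH, hone, -⟩ := hsig
  have hpos : ∃ i, 0 < hH.eigenvalues i := by
    obtain ⟨i, hi⟩ := Finset.card_pos.1 (hone ▸ Nat.one_pos)
    exact ⟨i, (Finset.mem_filter.1 hi).2⟩
  have hindec' : (Γ.map (Int.cast : ℤ → ℝ)).Indecomposable := fun ⟨I, hI, hI', h⟩ =>
    hindec ⟨I, hI, hI', fun i hi j hj => by simpa using h i hi j hj⟩
  obtain ⟨c, hc, w, hw, heig⟩ := hindec'.exists_pos_eigenvector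
    (fun i j hij => by simpa using hoff i j hij) hH hpos
  have hopen : IsOpen {x : Fin ρ → ℝ |
      ∀ i, 0 < x i ∧ 0 < (Γ.map (Int.cast : ℤ → ℝ) *ᵥ x) i} := by
    simp only [Set.ofPred_forall, Set.ofPred_and]
    refine isOpen_iInter_of_finite fun i => IsOpen.inter ?_ ?_
    · exact isOpen_lt continuous_const (continuous_apply i)
    · exact isOpen_lt continuous_const
        ((continuous_apply i).comp (continuous_const.matrix_mulVec continuous_id))
  obtain ⟨t, a, ht, ha⟩ := exists_nat_vector_smul_mem_of_isOpen hopen (fun i => (hw i).le)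
    fun i => ⟨hw i, by simpa [heig] using mul_pos hc (hw i)⟩
  have ha0 : ∀ i, (0 : ℤ) < a i := fun i => by
    have h := (ha i).1
    rw [Pi.smul_apply, smul_eq_mul, mul_pos_iff_of_pos_left (inv_pos.2 ht)] at h
    exact_mod_cast h
  have hΓa : ∀ j, 0 < (Γ *ᵥ fun i => (a i : ℤ)) j := fun j => by
    have h := (ha j).2
    rw [mulVec_smul, Pi.smul_apply, smul_eq_mul, mul_pos_iff_of_pos_left (inv_pos.2 ht)] at h
    simp only [mulVec, dotProduct, map_apply] at h ⊢
    exact_mod_cast h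
  exact ⟨fun i => a i, ha0, hΓa, Finset.sum_pos (fun i _ => mul_pos (ha0 i) (hΓa i))
    ⟨⟨0, hρ⟩, Finset.mem_univ _⟩⟩
end

section
/- For all integers ρ ≥ 3 and δ ≥ 1 there exists a constant N(ρ, δ) with the following property: for every symmetric ρ×ρ integer matrix Γ = (γ_{ij}) which is indecomposable, has signature (1, ρ−1) as a real symmetric matrix, and satisfies −δ ≤ γ_{ii} ≤ −1 for every i and 0 ≤ γ_{ij} ≤ 31δ for all i ≠ j, there exist positive integers a₁, …, a_ρ such that the vector h = (a₁, …, a_ρ) satisfies (Γh)_j > 0 for every j and 0 < hᵀΓh ≤ N(ρ, δ). -/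
open Matrix

namespace Matrix

variable {n : ℕ}

theorem Indecomposable.map_intCast {A : Matrix (Fin n) (Fin n) ℤ} (hA : A.Indecomposable) :
    (A.map (Int.cast : ℤ → ℝ)).Indecomposable := by
  rintro ⟨I, hI, hIc, h⟩
  exact hA ⟨I, hI, hIc, fun i hi j hj => by simpa using h i hi j hj⟩

/-- A nonnegative nonzero vector whose image is positive on its support can be enlarged to a
positive vector with positive image. -/
theorem Indecomposable.exists_pos_mulVec_pos {A : Matrix (Fin n) (Fin n) ℝ}
    (hA : A.Indecomposable) (hoff : ∀ i j, i ≠ j → 0 ≤ A i j) (x : Fin n → ℝ)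
    (hx : ∀ i, 0 ≤ x i) (hx0 : x ≠ 0) (hpos : ∀ i, 0 < x i → 0 < (A *ᵥ x) i) :
    ∃ y : Fin n → ℝ, (∀ i, 0 < y i) ∧ ∀ i, 0 < (A *ᵥ y) i := by
  induction hk : (Finset.univ.filter fun i => x i = 0).card using Nat.strong_induction_on
    generalizing x with
  | _ k ih =>
    by_cases hne : (Finset.univ.filter fun i => x i = 0).Nonempty
    swap
    · have hxp : ∀ i, 0 < x i := fun i => (hx i).lt_of_ne' fun h0 => hne ⟨i, by simpa using h0⟩
      exact ⟨x, hxp, fun i => hpos i (hxp i)⟩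
    · obtain ⟨m, hm⟩ := Function.ne_iff.mp hx0
      have hcut : ∃ i j, x i = 0 ∧ x j ≠ 0 ∧ A i j ≠ 0 := by
        by_contra! hcon
        exact hA ⟨_, hne, ⟨m, by simpa using hm⟩, fun i hi j hj =>
          hcon i j (by simpa using hi) (by simpa using hj)⟩
      obtain ⟨i, j, hi, hj, hij⟩ := hcut
      have hAx : 0 < (A *ᵥ x) i := by
        refine Finset.sum_pos' (fun l _ => ?_) ⟨j, Finset.mem_univ j, ?_⟩
        · by_cases hl : i = l
          · simp [← hl, hi]
          · exact mul_nonneg (hoff i l hl) (hx l)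
        · have hne : i ≠ j := fun h => hj (h ▸ hi)
          exact mul_pos ((hoff i j hne).lt_of_ne' hij) ((hx j).lt_of_ne' hj)
      obtain ⟨ε, hε, hεA⟩ : ∃ ε : ℝ, 0 < ε ∧ 0 < (A *ᵥ x) i + ε * A i i := by
        have hb : 0 < |A i i| + 1 := by positivity
        refine ⟨(A *ᵥ x) i / (|A i i| + 1), by positivity, ?_⟩
        have h : (A *ᵥ x) i + (A *ᵥ x) i / (|A i i| + 1) * A i i
            = (A *ᵥ x) i * (|A i i| + 1 + A i i) / (|A i i| + 1) := by
          field_simp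
        rw [h]
        have := neg_abs_le (A i i)
        exact div_pos (mul_pos hAx (by linarith)) hb
      have hs : ∀ l, 0 ≤ (Pi.single i ε : Fin n → ℝ) l := fun l =>
        (Pi.single_nonneg (i := i).mpr hε.le : 0 ≤ (Pi.single i ε : Fin n → ℝ)) l
      have hy : ∀ l, (A *ᵥ (x + Pi.single i ε)) l = (A *ᵥ x) l + ε * A l i := fun l => by
        simp [mulVec_add, mulVec_single]
      refine ih _ ?_ (x + (Pi.single i ε : Fin n → ℝ)) (fun l => ?_) (fun h => ?_) (fun l hl => ?_) rfl
      · rw [← hk]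
        refine Finset.card_lt_card (Finset.ssubset_iff_of_subset (fun l hl => ?_) |>.mpr
          ⟨i, by simpa using hi, by simp [hi, hε.ne']⟩)
        have hl' : (x + (Pi.single i ε : Fin n → ℝ)) l = 0 := by simpa using hl
        rw [Pi.add_apply] at hl'
        simpa using le_antisymm (by linarith [hs l]) (hx l)
      · exact add_nonneg (hx l) (hs l)
      · have := congrFun h i
        simp [hi, hε.ne'] at this
      · rw [hy]
        by_cases hli : l = i
        · rwa [hli]
        · have : 0 < x l := by simpa [hli] using hl
          exact add_pos_of_pos_of_nonneg (hpos l this) (mul_nonneg hε.le (hoff l i hli))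

/-- An eigenvector `u` for the eigenvalue `c` of a matrix with nonnegative off-diagonal entries
satisfies `c |u| ≤ A |u|` entrywise. -/
theorem mul_abs_le_mulVec_abs {A : Matrix (Fin n) (Fin n) ℝ}
    (hoff : ∀ i j, i ≠ j → 0 ≤ A i j) {u : Fin n → ℝ} {c : ℝ} (hu : A *ᵥ u = c • u)
    (i : Fin n) : c * |u i| ≤ (A *ᵥ |u|) i := by
  have key : ∀ s : ℝ, |s| = 1 → s * u i = |u i| → c * |u i| ≤ (A *ᵥ |u|) i := by
    intro s hs hsi
    have h : s * (A *ᵥ u) i = c * |u i| := by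
      rw [hu, ← hsi, Pi.smul_apply, smul_eq_mul]
      ring
    rw [← h, mulVec, dotProduct, Finset.mul_sum]
    refine Finset.sum_le_sum fun j _ => ?_
    rw [mul_left_comm, Pi.abs_apply]
    by_cases hij : i = j
    · rw [← hij, hsi]
    · refine mul_le_mul_of_nonneg_left ?_ (hoff i j hij)
      simpa [abs_mul, hs] using le_abs_self (s * u j)
  rcases abs_cases (u i) with h | h
  · exact key 1 (by simp) (by simp [h.1])
  · exact key (-1) (by simp) (by simp [h.1])

theorem HasSignatureOneHyperbolic.exists_eigenvector {A : Matrix (Fin n) (Fin n) ℝ}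
    (hA : A.HasSignatureOneHyperbolic) :
    ∃ c : ℝ, 0 < c ∧ ∃ u : Fin n → ℝ, u ≠ 0 ∧ A *ᵥ u = c • u := by
  obtain ⟨hH, h1, -⟩ := hA
  obtain ⟨i, hi⟩ := Finset.card_pos.mp (h1 ▸ Nat.one_pos)
  refine ⟨hH.eigenvalues i, by simpa using hi, hH.eigenvectorBasis i, fun h => ?_,
    hH.mulVec_eigenvectorBasis i⟩
  exact hH.eigenvectorBasis.orthonormal.ne_zero i ((WithLp.ofLp_eq_zero 2).mp h)

/-- A real positive vector with positive image under an integer matrix can be replaced by an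
integer one. -/
theorem exists_int_pos_mulVec_pos {A : Matrix (Fin n) (Fin n) ℤ} {x : Fin n → ℝ}
    (hx : ∀ i, 0 < x i) (hAx : ∀ i, 0 < (A.map (Int.cast : ℤ → ℝ) *ᵥ x) i) :
    ∃ a : Fin n → ℤ, (∀ i, 0 < a i) ∧ ∀ i, 0 < (A *ᵥ a) i := by
  have hlim : Filter.Tendsto (fun (t : ℝ) (i : Fin n) => (⌈x i * t⌉₊ : ℝ) / t) Filter.atTop
      (nhds x) := tendsto_pi_nhds.mpr fun i => tendsto_nat_ceil_mul_div_atTop (hx i).le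
  have hcont : Continuous fun y : Fin n → ℝ => A.map (Int.cast : ℤ → ℝ) *ᵥ y :=
    continuous_const.matrix_mulVec continuous_id
  have hev : ∀ᶠ t : ℝ in Filter.atTop, ∀ i,
      0 < (A.map (Int.cast : ℤ → ℝ) *ᵥ fun j => (⌈x j * t⌉₊ : ℝ) / t) i :=
    Filter.eventually_all.mpr fun i =>
      (tendsto_pi_nhds.mp ((hcont.tendsto x).comp hlim) i).eventually_const_lt (hAx i)
  obtain ⟨t, ht, ht0⟩ := (hev.and (Filter.eventually_gt_atTop 0)).exists
  refine ⟨fun i => ⌈x i * t⌉₊, fun i => ?_, fun i => ?_⟩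
  · exact Int.natCast_pos.mpr (Nat.ceil_pos.mpr (mul_pos (hx i) ht0))
  · have h : (A.map (Int.cast : ℤ → ℝ) *ᵥ fun j => (⌈x j * t⌉₊ : ℝ) / t) i
        = ((A *ᵥ fun j => (⌈x j * t⌉₊ : ℤ)) i : ℤ) / t := by
      simp [mulVec, dotProduct, Finset.sum_div, mul_div_assoc]
    have := ht i
    rw [h, div_pos_iff_of_pos_right ht0] at this
    exact_mod_cast this

theorem Indecomposable.exists_int_pos_mulVec_pos {A : Matrix (Fin n) (Fin n) ℤ}
    (hA : A.Indecomposable) (hsig : (A.map (Int.cast : ℤ → ℝ)).HasSignatureOneHyperbolic)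
    (hoff : ∀ i j, i ≠ j → 0 ≤ A i j) :
    ∃ a : Fin n → ℤ, (∀ i, 0 < a i) ∧ ∀ i, 0 < (A *ᵥ a) i := by
  have hoff' : ∀ i j, i ≠ j → 0 ≤ A.map (Int.cast : ℤ → ℝ) i j := fun i j hij => by
    simpa using hoff i j hij
  obtain ⟨c, hc, u, hu0, hu⟩ := hsig.exists_eigenvector
  obtain ⟨y, hy, hAy⟩ := hA.map_intCast.exists_pos_mulVec_pos hoff' |u| (fun i => abs_nonneg _)
    (by simpa using hu0) fun i hi =>
      (mul_pos hc hi).trans_le (mul_abs_le_mulVec_abs hoff' hu i)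
  exact Matrix.exists_int_pos_mulVec_pos hy hAy

theorem finite_setOf_forall_mem_Icc (b c : ℤ) :
    {A : Matrix (Fin n) (Fin n) ℤ | ∀ i j, A i j ∈ Set.Icc b c}.Finite := by
  refine (Set.Finite.pi' fun _ : Fin n => Set.Finite.pi' fun _ : Fin n =>
    Set.finite_Icc b c).subset fun A hA => ?_
  exact hA

end Matrix

/-- The lattice-theoretic core of Theorem 1.1: for fixed `ρ ≥ 3` and `δ ≥ 1`
there is a constant `N(ρ, δ)` such that for every indecomposable symmetric
integer matrix `Γ` of signature `(1, ρ-1)` with `-δ ≤ γ_{ii} ≤ -1` and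
`0 ≤ γ_{ij} ≤ 31δ` (for `i ≠ j`) there are positive integers `a₁, …, a_ρ`
with `(Γh)_j > 0` for all `j` and `0 < hᵀΓh ≤ N(ρ, δ)` for
`h = (a₁, …, a_ρ)`. -/
theorem bounded_ample_vector
    (ρ : ℕ) (hρ : 3 ≤ ρ) (δ : ℤ) (hδ : 1 ≤ δ) :
    ∃ N : ℤ, ∀ Γ : Matrix (Fin ρ) (Fin ρ) ℤ,
      Γ.IsSymm →
      Γ.Indecomposable →
      (Γ.map (Int.cast : ℤ → ℝ)).HasSignatureOneHyperbolic →
      (∀ i : Fin ρ, -δ ≤ Γ i i ∧ Γ i i ≤ -1) →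
      (∀ i j : Fin ρ, i ≠ j → 0 ≤ Γ i j ∧ Γ i j ≤ 31 * δ) →
      ∃ a : Fin ρ → ℤ, (∀ i, 0 < a i) ∧
        (∀ j, 0 < (Γ *ᵥ a) j) ∧
        0 < a ⬝ᵥ (Γ *ᵥ a) ∧ a ⬝ᵥ (Γ *ᵥ a) ≤ N := by
  classical
  let f : Matrix (Fin ρ) (Fin ρ) ℤ → ℤ := fun Γ =>
    if h : ∃ a : Fin ρ → ℤ, (∀ i, 0 < a i) ∧ ∀ i, 0 < (Γ *ᵥ a) i then
      h.choose ⬝ᵥ (Γ *ᵥ h.choose) else 0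
  obtain ⟨N, hN⟩ := ((finite_setOf_forall_mem_Icc (n := ρ) (-δ) (31 * δ)).image f).bddAbove
  refine ⟨N, fun Γ _ hind hsig hdiag hoff => ?_⟩
  have h := hind.exists_int_pos_mulVec_pos hsig fun i j hij => (hoff i j hij).1
  obtain ⟨ha, hΓa⟩ := h.choose_spec
  refine ⟨h.choose, ha, hΓa, ?_, ?_⟩
  · exact Finset.sum_pos (fun i _ => mul_pos (ha i) (hΓa i)) ⟨⟨0, by lia⟩, Finset.mem_univ _⟩
  · have hf : f Γ = h.choose ⬝ᵥ (Γ *ᵥ h.choose) := dif_pos h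
    rw [← hf]
    refine hN ⟨Γ, fun i j => ?_, rfl⟩
    by_cases hij : i = j
    · subst hij
      have := hdiag i
      exact ⟨this.1, by lia⟩
    · have := hoff i j hij
      exact ⟨by lia, this.2⟩
end

section
/- Let ρ ≥ 1, let Γ be a symmetric ρ×ρ integer matrix of signature (1, ρ−1) as a real symmetric matrix, and let k ∈ ℤ^ρ satisfy kᵀΓk > 0. Then for all integers δ ≥ 1 and p ≥ 0, the set of vectors e ∈ ℤ^ρ satisfying −δ ≤ eᵀΓe ≤ −1 and 0 ≤ eᵀΓe + eᵀΓk + 2 ≤ 2p is finite. -/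
open Matrix

/-- Real-number core of the reversed Cauchy-Schwarz argument: `z` and `P` are the positive and
negative parts of a bilinear pairing, `A - S` and `D - T` those of two squares. -/
lemma pos_part_le_of_pairing_bounded {A D S T z P M δ : ℝ} (hA : 0 ≤ A) (hT : 0 ≤ T)
    (hTD : T < D) (hδ : 0 ≤ δ) (hz : z ^ 2 = A * D) (hP : P ^ 2 ≤ S * T) (hS : S ≤ A + δ)
    (hM : |z - P| ≤ M) :
    A ≤ ((1 + 2 * D / (D - T)) * M ^ 2 + D * δ) / ((D - T) / 2) := by
  have hD : 0 < D := hT.trans_lt hTD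
  have hDT : 0 < D - T := sub_pos.mpr hTD
  have hM2 : (z - P) ^ 2 ≤ M ^ 2 := sq_le_sq' (by linarith [(abs_le.mp hM).1]) (abs_le.mp hM).2
  obtain ⟨t, ht⟩ : ∃ t, t = (D - T) / (2 * D) := ⟨_, rfl⟩
  have ht0 : 0 < t := by rw [ht]; positivity
  have htD : t * D = (D - T) / 2 := by rw [ht]; field_simp
  have hinv : 2 * D / (D - T) = 1 / t := by rw [ht]; field_simp
  have hyoung : z ^ 2 ≤ (1 + 1 / t) * (z - P) ^ 2 + (1 + t) * P ^ 2 := by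
    have : (1 + 1 / t) * (z - P) ^ 2 + (1 + t) * P ^ 2 - z ^ 2
        = (1 / t) * ((z - P) - t * P) ^ 2 := by field_simp; ring
    have : 0 ≤ (1 / t) * ((z - P) - t * P) ^ 2 := by positivity
    linarith
  have hfirst : (1 + 1 / t) * (z - P) ^ 2 ≤ (1 + 1 / t) * M ^ 2 := by gcongr
  have hPT : P ^ 2 ≤ (A + δ) * T := hP.trans (by gcongr)
  have hcoef : (1 + t) * T ≤ (D + T) / 2 := by nlinarith
  have hsecond : (1 + t) * P ^ 2 ≤ (D + T) / 2 * (A + δ) := calc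
    (1 + t) * P ^ 2 ≤ (1 + t) * ((A + δ) * T) := by gcongr
    _ = (1 + t) * T * (A + δ) := by ring
    _ ≤ _ := by gcongr
  rw [le_div_iff₀ (by positivity), hinv]
  nlinarith [mul_nonneg hδ hDT.le]

/-- For a diagonal form with exactly one positive coefficient, vectors whose square is bounded
below and whose pairing with a fixed positive vector is bounded form a bounded set. -/
lemma exists_sum_sq_le_of_diagonal_hyperbolic {ι : Type*} [Fintype ι] [DecidableEq ι]
    (c : ι → ℝ) (i₀ : ι) (hpos : 0 < c i₀) (hneg : ∀ i, i ≠ i₀ → c i < 0)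
    (y : ι → ℝ) (hy : 0 < ∑ i, c i * y i * y i) (M δ : ℝ) (hδ : 0 ≤ δ) :
    ∃ C, ∀ x : ι → ℝ, -δ ≤ ∑ i, c i * x i * x i → |∑ i, c i * x i * y i| ≤ M →
      ∑ i, x i * x i ≤ C := by
  have split (f : ι → ℝ) : ∑ i, f i = f i₀ - ∑ i ∈ Finset.univ.erase i₀, -f i := by
    rw [← Finset.add_sum_erase _ _ (Finset.mem_univ i₀), Finset.sum_neg_distrib]; ring
  have hnn (x : ι → ℝ) : ∀ i ∈ Finset.univ.erase i₀, 0 ≤ -(c i * x i * x i) := fun i hi => by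
    nlinarith [hneg i (Finset.ne_of_mem_erase hi), mul_self_nonneg (x i)]
  obtain ⟨C, hC⟩ : ∃ C, ∀ x : ι → ℝ, -δ ≤ ∑ i, c i * x i * x i → |∑ i, c i * x i * y i| ≤ M →
      c i₀ * x i₀ * x i₀ ≤ C := by
    let D := c i₀ * y i₀ * y i₀
    let T := ∑ i ∈ Finset.univ.erase i₀, -(c i * y i * y i)
    refine ⟨((1 + 2 * D / (D - T)) * M ^ 2 + D * δ) / ((D - T) / 2), fun x hx hxy => ?_⟩
    rw [split] at hx hxy hy
    refine pos_part_le_of_pairing_bounded (mul_assoc (c i₀) _ _ ▸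
      mul_nonneg hpos.le (mul_self_nonneg _)) (Finset.sum_nonneg (hnn y)) (sub_pos.mp hy) hδ
      (z := c i₀ * x i₀ * y i₀) (by simp only [D]; ring) ?_ (S := ∑ i ∈ Finset.univ.erase i₀, -(c i * x i * x i))
      (by linarith) hxy
    exact Finset.sum_sq_le_sum_mul_sum_of_sq_le_mul _ (hnn x) (hnn y) fun i _ =>
      le_of_eq (by ring)
  refine ⟨∑ i, (|C| + δ) / |c i|, fun x hx hxy => Finset.sum_le_sum fun i _ => ?_⟩
  have h0 := hC x hx hxy
  have hCabs := le_abs_self C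
  by_cases hi : i = i₀
  · subst hi
    rw [abs_of_pos hpos, le_div_iff₀ hpos]
    linarith
  · rw [abs_of_neg (hneg i hi), le_div_iff₀ (neg_pos.mpr (hneg i hi))]
    rw [split] at hx
    have := Finset.single_le_sum (hnn x) (Finset.mem_erase.mpr ⟨hi, Finset.mem_univ i⟩)
    linarith

lemma Matrix.HasSignatureOneHyperbolic.exists_eigenvalues_neg {n : ℕ}
    {A : Matrix (Fin n) (Fin n) ℝ} (h : A.HasSignatureOneHyperbolic) :
    ∃ hA : A.IsHermitian, ∃ i₀, 0 < hA.eigenvalues i₀ ∧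
      ∀ i, i ≠ i₀ → hA.eigenvalues i < 0 := by
  obtain ⟨hA, h1, h2⟩ := h
  obtain ⟨i₀, hi₀⟩ := Finset.card_eq_one.mp h1
  have hp : 0 < hA.eigenvalues i₀ := by
    simpa using (Finset.ext_iff.mp hi₀ i₀).mpr (Finset.mem_singleton_self i₀)
  refine ⟨hA, i₀, hp, fun i hi => ?_⟩
  have hsub : (Finset.univ.filter fun i => hA.eigenvalues i < 0) ⊆ Finset.univ.erase i₀ := by
    intro j hj
    refine Finset.mem_erase.mpr ⟨?_, Finset.mem_univ j⟩
    rintro rfl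
    exact lt_asymm hp (Finset.mem_filter.mp hj).2
  have heq := Finset.eq_of_subset_of_card_le hsub (by
    rw [h2, Finset.card_erase_of_mem (Finset.mem_univ _), Finset.card_fin])
  have hmem := heq.symm.subset (Finset.mem_erase.mpr ⟨hi, Finset.mem_univ i⟩)
  exact (Finset.mem_filter.mp hmem).2

lemma Matrix.IsHermitian.dotProduct_mulVec_eq_sum {n : ℕ} {A : Matrix (Fin n) (Fin n) ℝ}
    (hA : A.IsHermitian) (x y : Fin n → ℝ) :
    x ⬝ᵥ (A *ᵥ y) = ∑ i, hA.eigenvalues i *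
      ((hA.eigenvectorUnitary : Matrix (Fin n) (Fin n) ℝ)ᵀ *ᵥ x) i *
      ((hA.eigenvectorUnitary : Matrix (Fin n) (Fin n) ℝ)ᵀ *ᵥ y) i := by
  set U := (hA.eigenvectorUnitary : Matrix (Fin n) (Fin n) ℝ) with hU
  have hspec : A = U * diagonal hA.eigenvalues * Uᵀ := by
    conv_lhs => rw [hA.spectral_theorem, Unitary.conjStarAlgAut_apply]
    simp [hU, star_eq_conjTranspose, conjTranspose_eq_transpose_of_trivial]
  conv_lhs => rw [hspec, ← mulVec_mulVec, ← mulVec_mulVec, dotProduct_mulVec, ← mulVec_transpose]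
  simp only [dotProduct, mulVec_diagonal]
  exact Finset.sum_congr rfl fun i _ => by ring

lemma Matrix.IsHermitian.sum_eigenvectorUnitary_transpose_mulVec_sq {n : ℕ}
    {A : Matrix (Fin n) (Fin n) ℝ} (hA : A.IsHermitian) (x : Fin n → ℝ) :
    ∑ i, ((hA.eigenvectorUnitary : Matrix (Fin n) (Fin n) ℝ)ᵀ *ᵥ x) i *
      ((hA.eigenvectorUnitary : Matrix (Fin n) (Fin n) ℝ)ᵀ *ᵥ x) i = ∑ i, x i * x i := by
  set U := (hA.eigenvectorUnitary : Matrix (Fin n) (Fin n) ℝ) with hU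
  have hUU : U * Uᵀ = 1 := by
    simpa [star_eq_conjTranspose, conjTranspose_eq_transpose_of_trivial] using
      Unitary.mul_star_self_of_mem hA.eigenvectorUnitary.2
  change (Uᵀ *ᵥ x) ⬝ᵥ (Uᵀ *ᵥ x) = x ⬝ᵥ x
  rw [dotProduct_mulVec, ← mulVec_transpose, transpose_transpose, mulVec_mulVec, hUU, one_mulVec]

lemma intCast_dotProduct_mulVec {n : ℕ} (Γ : Matrix (Fin n) (Fin n) ℤ) (x y : Fin n → ℤ) :
    ((x ⬝ᵥ (Γ *ᵥ y) : ℤ) : ℝ) =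
      (fun i => (x i : ℝ)) ⬝ᵥ (Γ.map (Int.cast : ℤ → ℝ) *ᵥ fun i => (y i : ℝ)) := by
  simp [dotProduct, mulVec]

lemma finite_setOf_sum_sq_le {n : ℕ} (C : ℝ) :
    {e : Fin n → ℤ | ∑ i, (e i : ℝ) * (e i : ℝ) ≤ C}.Finite := by
  refine (Set.finite_Icc (fun _ => -⌈C⌉) (fun _ => ⌈C⌉)).subset fun e he => ?_
  have key (i : Fin n) : |e i| ≤ ⌈C⌉ := by
    have h1 : (e i : ℝ) * e i ≤ C :=
      (Finset.single_le_sum (f := fun i => (e i : ℝ) * e i) (fun j _ => mul_self_nonneg _)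
        (Finset.mem_univ i)).trans he
    have h2 : e i * e i ≤ ⌈C⌉ := by exact_mod_cast h1.trans (Int.le_ceil C)
    have h3 : |e i| ≤ |e i| * |e i| := by nlinarith [abs_nonneg (e i), Int.le_self_sq |e i|]
    exact h3.trans ((abs_mul_abs_self (e i)).le.trans h2)
  exact ⟨fun i => (abs_le.mp (key i)).1, fun i => (abs_le.mp (key i)).2⟩

/-- Finiteness step in Theorem 1.2: in a hyperbolic integral lattice with Gram
matrix `Γ` and a vector `k` with `k² > 0`, the set of vectors `e` with
`-δ ≤ e² ≤ -1` and arithmetic genus condition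
`0 ≤ e² + e·k + 2 ≤ 2p` is finite. -/
theorem finiteness_exceptional_classes
    (ρ : ℕ) (hρ : 1 ≤ ρ) (Γ : Matrix (Fin ρ) (Fin ρ) ℤ)
    (hsym : Γ.IsSymm)
    (hsig : (Γ.map (Int.cast : ℤ → ℝ)).HasSignatureOneHyperbolic)
    (k : Fin ρ → ℤ) (hk : 0 < k ⬝ᵥ (Γ *ᵥ k))
    (δ p : ℤ) (hδ : 1 ≤ δ) (hp : 0 ≤ p) :
    {e : Fin ρ → ℤ |
      (-δ ≤ e ⬝ᵥ (Γ *ᵥ e) ∧ e ⬝ᵥ (Γ *ᵥ e) ≤ -1) ∧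
      (0 ≤ e ⬝ᵥ (Γ *ᵥ e) + e ⬝ᵥ (Γ *ᵥ k) + 2 ∧
        e ⬝ᵥ (Γ *ᵥ e) + e ⬝ᵥ (Γ *ᵥ k) + 2 ≤ 2 * p)}.Finite := by
  obtain ⟨hA, i₀, hpos, hneg⟩ := hsig.exists_eigenvalues_neg
  have hk' : (0 : ℝ) < (k ⬝ᵥ (Γ *ᵥ k) : ℤ) := by exact_mod_cast hk
  rw [intCast_dotProduct_mulVec, hA.dotProduct_mulVec_eq_sum] at hk'
  obtain ⟨C, hC⟩ := exists_sum_sq_le_of_diagonal_hyperbolic _ i₀ hpos hneg _ hk'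
    (2 * p + δ + 2 : ℤ) δ (by exact_mod_cast (by omega : 0 ≤ δ))
  refine (finite_setOf_sum_sq_le C).subset ?_
  rintro e ⟨⟨h1, h2⟩, h3, h4⟩
  have hle : |e ⬝ᵥ (Γ *ᵥ k)| ≤ 2 * p + δ + 2 := abs_le.mpr ⟨by omega, by omega⟩
  have hb := hC _
    (by rw [← hA.dotProduct_mulVec_eq_sum, ← intCast_dotProduct_mulVec Γ e e]; exact_mod_cast h1)
    (by rw [← hA.dotProduct_mulVec_eq_sum, ← intCast_dotProduct_mulVec Γ e k]; exact_mod_cast hle)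
  rwa [hA.sum_eigenvectorUnitary_transpose_mulVec_sq] at hb
end

section
/- Let n ≥ 2 and let Γ be a real symmetric n×n matrix such that: all off-diagonal entries of Γ are nonnegative; every (n−1)×(n−1) principal submatrix of Γ (obtained by deleting the i-th row and i-th column, for each i) is negative semidefinite; and xᵀΓx > 0 for some x ∈ ℝⁿ. Then every x ∈ ℝⁿ with xᵀΓx > 0 has either all coordinates strictly positive or all coordinates strictly negative. -/
open Matrix

/-- The quadratic form of `A` is nonpositive on vectors vanishing at `i`, if the principal submatrix
of `A` deleting the row and column `i` is negative semidefinite. -/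
lemma dotProduct_mulVec_nonpos_of_apply_eq_zero {ι : Type*} [Fintype ι] [DecidableEq ι]
    {A : Matrix ι ι ℝ} {i : ι}
    (hA : (-(A.submatrix (fun j : {j : ι // j ≠ i} => (j : ι))
      (fun j : {j : ι // j ≠ i} => (j : ι)))).PosSemidef)
    {v : ι → ℝ} (hv : v i = 0) : v ⬝ᵥ (A *ᵥ v) ≤ 0 := by
  have sum_eq (f : ι → ℝ) (hf : f i = 0) : ∑ j : {j : ι // j ≠ i}, f j = ∑ j, f j := by
    rw [Fintype.sum_eq_add_sum_subtype_ne f i, hf, zero_add]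
  have h := hA.dotProduct_mulVec_nonneg (fun j => v j)
  simp only [neg_mulVec, dotProduct_neg, Left.nonneg_neg_iff] at h
  refine le_of_eq_of_le ?_ h
  simp only [dotProduct, mulVec, submatrix_apply, Pi.star_apply, star_trivial]
  rw [← sum_eq _ (by simp [hv])]
  refine Finset.sum_congr rfl fun k _ => ?_
  rw [← sum_eq (fun j => A k j * v j) (by simp [hv])]

/-- If the off-diagonal entries of `A` are nonnegative, the bilinear form of `A` is nonnegative on
the positive and negative parts of a vector. -/
lemma posPart_dotProduct_mulVec_negPart_nonneg {ι : Type*} [Fintype ι] {A : Matrix ι ι ℝ}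
    (hA : ∀ i j, i ≠ j → 0 ≤ A i j) (x : ι → ℝ) : 0 ≤ x⁺ ⬝ᵥ (A *ᵥ x⁻) := by
  simp only [dotProduct, mulVec, Finset.mul_sum]
  refine Finset.sum_nonneg fun i _ => Finset.sum_nonneg fun j _ => ?_
  rw [Pi.posPart_apply, Pi.negPart_apply]
  obtain rfl | hij := eq_or_ne i j
  · obtain hx | hx := le_total (x i) 0
    · simp [posPart_eq_zero.2 hx]
    · simp [negPart_eq_zero.2 hx]
  · exact mul_nonneg (posPart_nonneg _) (mul_nonneg (hA i j hij) (negPart_nonneg _))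

/-- Criterion behind Example 1.2: if a real symmetric matrix `Γ` has
nonnegative off-diagonal entries, every principal `(n-1) × (n-1)` submatrix
(deleting the `i`-th row and column) is negative semidefinite, and the
quadratic form of `Γ` takes a positive value, then every vector `x` with
`xᵀΓx > 0` has either all coordinates positive or all coordinates negative. -/
theorem positive_square_vectors_in_simplicial_cone
    (n : ℕ) (hn : 2 ≤ n) (Γ : Matrix (Fin n) (Fin n) ℝ)
    (hsym : Γ.IsSymm)
    (hoff : ∀ i j : Fin n, i ≠ j → 0 ≤ Γ i j)
    (hprin : ∀ i : Fin n,
      (-(Γ.submatrix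
          (fun j : {j : Fin n // j ≠ i} => (j : Fin n))
          (fun j : {j : Fin n // j ≠ i} => (j : Fin n)))).PosSemidef)
    (hpos : ∃ x : Fin n → ℝ, 0 < x ⬝ᵥ (Γ *ᵥ x)) :
    ∀ x : Fin n → ℝ, 0 < x ⬝ᵥ (Γ *ᵥ x) →
      (∀ i, 0 < x i) ∨ (∀ i, x i < 0) := by
  intro x hx
  by_contra! h
  obtain ⟨⟨i, hi⟩, j, hj⟩ := h
  have hp : x⁺ ⬝ᵥ (Γ *ᵥ x⁺) ≤ 0 :=
    dotProduct_mulVec_nonpos_of_apply_eq_zero (hprin i) (by simpa using hi)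
  have hm : x⁻ ⬝ᵥ (Γ *ᵥ x⁻) ≤ 0 :=
    dotProduct_mulVec_nonpos_of_apply_eq_zero (hprin j) (by simpa using hj)
  have hpm := posPart_dotProduct_mulVec_negPart_nonneg hoff x
  have hmp : x⁻ ⬝ᵥ (Γ *ᵥ x⁺) = x⁺ ⬝ᵥ (Γ *ᵥ x⁻) := by
    rw [dotProduct_mulVec, ← mulVec_transpose, hsym.eq, dotProduct_comm]
  rw [← posPart_sub_negPart x, mulVec_sub, sub_dotProduct, dotProduct_sub, dotProduct_sub] at hx
  linarith
end

section
/- Let n ≥ 1 be an integer and let M be the symmetric 3×3 real matrix with rows (−n, 1, 0), (1, −1, 1), (0, 1, −1). Then every vector x = (a, b, c) ∈ ℝ³ with xᵀMx > 0 has either a > 0, b > 0 and c > 0, or a < 0, b < 0 and c < 0. -/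
open Matrix

/-- Example 1.2: for the intersection matrix of the curves `C_g, E₀, F₀` on
the blow-up of the ruled surface, every vector of positive square has either
all coordinates positive or all coordinates negative. -/
theorem example_ruled_cone (n : ℕ) (hn : 1 ≤ n) :
    ∀ x : Fin 3 → ℝ,
      0 < x ⬝ᵥ ((!![-(n : ℝ), 1, 0; 1, -1, 1; 0, 1, -1]) *ᵥ x) →
      (0 < x 0 ∧ 0 < x 1 ∧ 0 < x 2) ∨ (x 0 < 0 ∧ x 1 < 0 ∧ x 2 < 0) := by
  intro x hx
  have hn' : (1 : ℝ) ≤ n := by exact_mod_cast hn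
  have hform : 0 < -n * x 0 ^ 2 - x 1 ^ 2 - x 2 ^ 2 + 2 * (x 0 * x 1) + 2 * (x 1 * x 2) := by
    convert hx using 1
    simp [Matrix.mulVec, dotProduct, Fin.sum_univ_three]
    ring
  have hsq : x 0 ^ 2 ≤ n * x 0 ^ 2 := le_mul_of_one_le_left (sq_nonneg _) hn'
  have hab : 0 < x 0 * x 1 := by nlinarith [sq_nonneg (x 0), sq_nonneg (x 1 - x 2)]
  have hbc : 0 < x 1 * x 2 := by nlinarith [sq_nonneg (x 0 - x 1), sq_nonneg (x 2)]
  rcases mul_pos_iff.mp hab with ⟨ha, hb⟩ | ⟨ha, hb⟩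
  · exact Or.inl ⟨ha, hb, (mul_pos_iff_of_pos_left hb).mp hbc⟩
  · exact Or.inr ⟨ha, hb, neg_of_mul_pos_right hbc hb.le⟩
end

section
/- Let Γ be the symmetric 10×10 integer matrix defined by: Γ_{ii} = −2 for 1 ≤ i ≤ 9, Γ_{10,10} = −1; Γ_{ij} = Γ_{ji} = 1 for the pairs {i,j} ∈ {{2,3}, {3,4}, {4,5}, {5,6}, {6,7}, {7,8}, {8,9}, {9,10}, {1,4}}; and Γ_{ij} = 0 for all other pairs i ≠ j. Then every x ∈ ℝ¹⁰ satisfying (Γx)_i ≥ 0 for all i ∈ {1,…,10} satisfies xᵀΓx ≥ 0. -/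
open Matrix

/-- The Gram (intersection) matrix of the ten exceptional curves `E₁, …, E₁₀`
with dual graph `HẼ₈` from Example 1.4.1: `E₁, …, E₉` are `(-2)`-curves forming
the extended Dynkin diagram `Ẽ₈` (a chain `E₂–E₃–E₄–E₅–E₆–E₇–E₈–E₉` with `E₁`
attached to `E₄`), and `E₁₀` is a `(-1)`-curve attached to `E₉`. -/
def gramHE8 : Matrix (Fin 10) (Fin 10) ℝ :=
  !![-2,  0,  0,  1,  0,  0,  0,  0,  0,  0;
      0, -2,  1,  0,  0,  0,  0,  0,  0,  0;
      0,  1, -2,  1,  0,  0,  0,  0,  0,  0;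
      1,  0,  1, -2,  1,  0,  0,  0,  0,  0;
      0,  0,  0,  1, -2,  1,  0,  0,  0,  0;
      0,  0,  0,  0,  1, -2,  1,  0,  0,  0;
      0,  0,  0,  0,  0,  1, -2,  1,  0,  0;
      0,  0,  0,  0,  0,  0,  1, -2,  1,  0;
      0,  0,  0,  0,  0,  0,  0,  1, -2,  1;
      0,  0,  0,  0,  0,  0,  0,  0,  1, -1]

/-- The inverse of `gramHE8` has nonnegative entries, so vectors in the dual cone are effective. -/
theorem nonneg_of_gramHE8_mulVec_nonneg (x : Fin 10 → ℝ) (hx : ∀ i, 0 ≤ (gramHE8 *ᵥ x) i)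
    (i : Fin 10) : 0 ≤ x i := by
  simp [Fin.forall_fin_succ, gramHE8, mulVec, dotProduct, Fin.sum_univ_succ] at hx
  obtain ⟨h₁, h₂, h₃, h₄, h₅, h₆, h₇, h₈, h₉, h₁₀⟩ := hx
  fin_cases i <;> simp <;> linarith

/-- The dual cone of the curves with graph `HẼ₈` is contained in the closure
of the light cone: any `x` with `(Γx)_i ≥ 0` for all `i` has `xᵀΓx ≥ 0`. -/
theorem dual_cone_HE8_in_light_cone :
    ∀ x : Fin 10 → ℝ, (∀ i, 0 ≤ (gramHE8 *ᵥ x) i) → 0 ≤ x ⬝ᵥ (gramHE8 *ᵥ x) := by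
  exact fun x hx ↦ Finset.sum_nonneg fun i _ ↦
    mul_nonneg (nonneg_of_gramHE8_mulVec_nonneg x hx i) (hx i)
end

section
/- Let Γ be the symmetric 11×11 integer matrix defined by: Γ_{ii} = −2 for i ∈ {1,2,3,4,5,6,7,8,10}, Γ_{ii} = −1 for i ∈ {9,11}; Γ_{ij} = Γ_{ji} = 1 for the pairs {i,j} ∈ {{11,10}, {10,7}, {7,1}, {7,5}, {5,3}, {3,2}, {2,6}, {6,4}, {6,8}, {8,9}}; and Γ_{ij} = 0 for all other pairs i ≠ j. Then every x ∈ ℝ¹¹ satisfying (Γx)_i ≥ 0 for all i ∈ {1,…,11} satisfies xᵀΓx ≥ 0. -/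
open Matrix

/-- The Gram (intersection) matrix of the eleven exceptional curves
`E₁, …, E₁₁` with dual graph `HD̃₈` from Example 1.4.1: the nine `(-2)`-curves
`E₁, …, E₈, E₁₀` form the extended Dynkin diagram `D̃₈` (a central chain
`E₇–E₅–E₃–E₂–E₆` with `E₁₀` and `E₁` attached to `E₇` and with `E₄` and `E₈`
attached to `E₆`), and `E₉, E₁₁` are `(-1)`-curves attached to `E₈` and `E₁₀`
respectively. -/
def gramHD8 : Matrix (Fin 11) (Fin 11) ℝ :=
  !![-2,  0,  0,  0,  0,  0,  1,  0,  0,  0,  0;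
      0, -2,  1,  0,  0,  1,  0,  0,  0,  0,  0;
      0,  1, -2,  0,  1,  0,  0,  0,  0,  0,  0;
      0,  0,  0, -2,  0,  1,  0,  0,  0,  0,  0;
      0,  0,  1,  0, -2,  0,  1,  0,  0,  0,  0;
      0,  1,  0,  1,  0, -2,  0,  1,  0,  0,  0;
      1,  0,  0,  0,  1,  0, -2,  0,  0,  1,  0;
      0,  0,  0,  0,  0,  1,  0, -2,  1,  0,  0;
      0,  0,  0,  0,  0,  0,  0,  1, -1,  0,  0;
      0,  0,  0,  0,  0,  0,  1,  0,  0, -2,  1;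
      0,  0,  0,  0,  0,  0,  0,  0,  0,  1, -1]

/-- If a symmetric real matrix `A` has an entrywise nonnegative generalized inverse `B`, in the
scaled sense `A * B * A = c • A` with `0 < c`, then the quadratic form of `A` is nonnegative on
the dual cone `{x | 0 ≤ A *ᵥ x}`. -/
theorem Matrix.IsSymm.dotProduct_mulVec_nonneg_of_mul_mul_eq_smul {n : Type*} [Fintype n]
    {A B : Matrix n n ℝ} (hA : A.IsSymm) (hB : ∀ i j, 0 ≤ B i j) {c : ℝ} (hc : 0 < c)
    (h : A * B * A = c • A) {x : n → ℝ} (hx : ∀ i, 0 ≤ (A *ᵥ x) i) :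
    0 ≤ x ⬝ᵥ (A *ᵥ x) := by
  have key : c * (x ⬝ᵥ (A *ᵥ x)) = (A *ᵥ x) ⬝ᵥ (B *ᵥ (A *ᵥ x)) := by
    rw [← smul_eq_mul, ← dotProduct_smul, ← smul_mulVec, ← h, ← mulVec_mulVec, ← mulVec_mulVec,
      dotProduct_mulVec, ← mulVec_transpose, hA.eq]
  have hnonneg : 0 ≤ (A *ᵥ x) ⬝ᵥ (B *ᵥ (A *ᵥ x)) :=
    Finset.sum_nonneg fun i _ => mul_nonneg (hx i)
      (Finset.sum_nonneg fun j _ => mul_nonneg (hB i j) (hx j))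
  exact nonneg_of_mul_nonneg_right (key ▸ hnonneg) hc

/-- The matrix `gramHD8` with integer entries. -/
def gramHD8Int : Matrix (Fin 11) (Fin 11) ℤ :=
  !![-2,  0,  0,  0,  0,  0,  1,  0,  0,  0,  0;
      0, -2,  1,  0,  0,  1,  0,  0,  0,  0,  0;
      0,  1, -2,  0,  1,  0,  0,  0,  0,  0,  0;
      0,  0,  0, -2,  0,  1,  0,  0,  0,  0,  0;
      0,  0,  1,  0, -2,  0,  1,  0,  0,  0,  0;
      0,  1,  0,  1,  0, -2,  0,  1,  0,  0,  0;
      1,  0,  0,  0,  1,  0, -2,  0,  0,  1,  0;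
      0,  0,  0,  0,  0,  1,  0, -2,  1,  0,  0;
      0,  0,  0,  0,  0,  0,  0,  1, -1,  0,  0;
      0,  0,  0,  0,  0,  0,  1,  0,  0, -2,  1;
      0,  0,  0,  0,  0,  0,  0,  0,  0,  1, -1]

/-- A nonnegative integer matrix which is, up to the factor `4`, a generalized inverse of the
(singular) matrix `gramHD8`. -/
def gramHD8GenInv : Matrix (Fin 11) (Fin 11) ℤ :=
  !![ 0,  2,  2,  0,  2,  2,  2,  1,  0,  3,  4;
      2,  0,  2,  2,  4,  2,  6,  3,  4,  5,  4;
      2,  2,  0,  2,  2,  4,  4,  4,  4,  4,  4;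
      0,  2,  2,  0,  2,  2,  2,  3,  4,  1,  0;
      2,  4,  2,  2,  0,  6,  2,  5,  4,  3,  4;
      2,  2,  4,  2,  6,  0,  8,  2,  4,  6,  4;
      2,  6,  4,  2,  2,  8,  0,  6,  4,  2,  4;
      1,  3,  4,  3,  5,  2,  6,  0,  2,  4,  2;
      0,  4,  4,  4,  4,  4,  4,  2,  0,  2,  0;
      3,  5,  4,  1,  3,  6,  2,  4,  2,  0,  2;
      4,  4,  4,  0,  4,  4,  4,  2,  0,  2,  0]

theorem gramHD8_eq_map : gramHD8 = gramHD8Int.map (Int.castRingHom ℝ) := by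
  ext i j
  fin_cases i <;> fin_cases j <;> simp [gramHD8, gramHD8Int]

theorem gramHD8Int_isSymm : gramHD8Int.IsSymm := by
  unfold Matrix.IsSymm
  decide +kernel

theorem gramHD8GenInv_nonneg : ∀ i j, 0 ≤ gramHD8GenInv i j := by
  intro i j
  fin_cases i <;> fin_cases j <;> simp [gramHD8GenInv]

theorem gramHD8Int_mul_genInv_mul :
    gramHD8Int * gramHD8GenInv * gramHD8Int = (4 : ℤ) • gramHD8Int := by
  decide +kernel

/-- The dual cone of the curves with graph `HD̃₈` is contained in the closure
of the light cone: any `x` with `(Γx)_i ≥ 0` for all `i` has `xᵀΓx ≥ 0`. -/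
theorem dual_cone_HD8_in_light_cone :
    ∀ x : Fin 11 → ℝ, (∀ i, 0 ≤ (gramHD8 *ᵥ x) i) → 0 ≤ x ⬝ᵥ (gramHD8 *ᵥ x) := by
  intro x hx
  refine IsSymm.dotProduct_mulVec_nonneg_of_mul_mul_eq_smul
    (B := gramHD8GenInv.map (Int.castRingHom ℝ)) (c := 4) ?_ ?_ (by norm_num) ?_ hx
  · rw [gramHD8_eq_map]
    exact gramHD8Int_isSymm.map _
  · intro i j
    simpa using gramHD8GenInv_nonneg i j
  · rw [gramHD8_eq_map, ← Matrix.map_mul, ← Matrix.map_mul, gramHD8Int_mul_genInv_mul]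
    ext i j
    simp [-zsmul_eq_mul, Matrix.smul_apply]
end
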